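/- arXiv:2106.13506 — 4 statements merged into one kernel-verified Lean document; each statement's English description precedes it below -/
import Mathlib

section
/- Let M be an infinite type and let μ = #M be its cardinality. Then the following are equivalent: (1) there exists a binary relation E : M → M → Prop satisfying extensionality and ω-closure; (2) μ ^ ℵ₀ = μ (cardinal exponentiation). (This identifies the spectrum of the infinitary extensionality-plus-countable-codes sentence of the paper: it has models exactly in the infinite cardinalities μ with μ^ℵ₀ = μ.) -/
universe u

open Cardinal

/-- Countable subsets suffice to code sequences: if each range of a sequence in an infinite type `M`
is the extension of some element, then `M` has at least as many elements as sequences. -/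
theorem mk_pow_aleph0_le_of_forall_range_coded {M : Type u} [Infinite M] {E : M → M → Prop}
    (hE : ∀ f : ℕ → M, ∃ y : M, ∀ z : M, E z y ↔ ∃ n : ℕ, z = f n) :
    (#M) ^ (ℵ₀ : Cardinal.{u}) ≤ #M := by
  have hprod : #(ℕ × M) = #M := by
    simp [mk_prod, aleph0_mul_eq (aleph0_le_mk M)]
  obtain ⟨e⟩ := Cardinal.eq.1 hprod
  choose c hc using fun f : ℕ → M => hE fun n => e (n, f n)
  have hinj : Function.Injective c := by
    intro f g hfg
    funext n
    obtain ⟨m, hm⟩ := (hc g _).1 (hfg ▸ (hc f (e (n, f n))).2 ⟨n, rfl⟩)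
    obtain ⟨rfl, h⟩ := Prod.ext_iff.1 (e.injective hm)
    exact h
  simpa using mk_le_of_injective hinj

/-- If `M` has as many elements as sequences, it has as many elements as ranges of sequences. -/
theorem mk_range_range_eq_of_pow_aleph0_eq {M : Type u}
    (h : (#M) ^ (ℵ₀ : Cardinal.{u}) = #M) :
    #(Set.range (Set.range : (ℕ → M) → Set M)) = #M := by
  apply le_antisymm
  · refine mk_range_le.trans ?_
    simp [h]
  · refine mk_le_of_injective
      (f := fun x : M => ⟨Set.range fun _ : ℕ => x, Set.mem_range_self _⟩) fun x y hxy => ?_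
    simpa using congrArg Subtype.val hxy

/-- An infinite type `M` carries a binary relation `E` satisfying
extensionality and ω-closure iff `(#M) ^ ℵ₀ = #M`. -/
theorem exists_extensional_omega_closed_iff_pow_aleph0_eq (M : Type u) [Infinite M] :
    (∃ E : M → M → Prop,
        (∀ x y : M, (∀ z : M, E z x ↔ E z y) → x = y) ∧
        (∀ f : ℕ → M, ∃ y : M, ∀ z : M, E z y ↔ ∃ n : ℕ, z = f n)) ↔
    (#M) ^ (ℵ₀ : Cardinal.{u}) = #M := by
  constructor
  · rintro ⟨E, -, hE⟩
    exact (mk_pow_aleph0_le_of_forall_range_coded hE).antisymm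
      (self_le_power _ one_le_aleph0)
  · intro h
    obtain ⟨e⟩ := Cardinal.eq.1 (mk_range_range_eq_of_pow_aleph0_eq h)
    refine ⟨fun z y => z ∈ (e.symm y : Set M), fun x y hxy => ?_, fun f => ?_⟩
    · exact e.symm.injective (Subtype.ext (Set.ext hxy))
    · refine ⟨e ⟨Set.range f, Set.mem_range_self f⟩, fun z => ?_⟩
      simp [eq_comm]
end

section
/- Let M be an infinite type and suppose E : M → M → Prop satisfies extensionality and ω-closure. Then the cofinality of the cardinal #M is not ℵ₀; that is, the cardinality of such a structure can never be a cardinal of cofinality ω. -/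
universe u

open Cardinal

/-- On an infinite type, a relation satisfying ω-closure makes `#M ^ ℵ₀ ≤ #M`: a sequence is coded
by the element whose predecessors are the points of its graph. -/
theorem power_aleph0_le_of_omega_closed (M : Type u) [Infinite M] (E : M → M → Prop)
    (hclo : ∀ f : ℕ → M, ∃ y : M, ∀ z : M, E z y ↔ ∃ n : ℕ, z = f n) :
    #M ^ (ℵ₀ : Cardinal.{u}) ≤ #M := by
  have h_card : #(ℕ × M) = #M := by simp
  obtain ⟨e⟩ := Cardinal.eq.1 h_card
  choose c hc using hclo
  have h_inj : Function.Injective fun f : ℕ → M => c fun n => e (n, f n) := by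
    intro f g hfg
    funext n
    have h_mem := (hc (fun n => e (n, f n)) (e (n, f n))).2 ⟨n, rfl⟩
    rw [show c (fun n => e (n, f n)) = c (fun n => e (n, g n)) from hfg, hc] at h_mem
    obtain ⟨m, hm⟩ := h_mem
    obtain ⟨rfl, h⟩ := Prod.mk.inj (e.injective hm)
    exact h
  simpa using Cardinal.mk_le_of_injective h_inj

/-- If an infinite type `M` carries a relation `E` satisfying extensionality
and ω-closure, then the cofinality of `#M` is not `ℵ₀`. -/
theorem cof_ne_aleph0_of_extensional_omega_closed (M : Type u) [Infinite M]
    (E : M → M → Prop)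
    (hext : ∀ x y : M, (∀ z : M, E z x ↔ E z y) → x = y)
    (hclo : ∀ f : ℕ → M, ∃ y : M, ∀ z : M, E z y ↔ ∃ n : ℕ, z = f n) :
    (#M).ord.cof ≠ ℵ₀ := by
  intro h
  have h_lt := lt_power_cof_ord (aleph0_le_mk M)
  rw [h] at h_lt
  exact h_lt.not_ge (power_aleph0_le_of_omega_closed M E hclo)
end

section
/- An infinite cardinal μ is a limit cardinal (i.e. μ is not the cardinal successor of any cardinal) if and only if there exist a type α with #α = μ and a linear order < on α such that for every x : α there is y : α with x < y and #{z : α | z < x} < #{z : α | z < y}. (This identifies the spectrum of the sentence φ_lim of the logic with the Härtig quantifier: the class of infinite limit cardinals.) -/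
universe u

open Cardinal

/-- A type is no larger than `c * d` if it maps to a type of cardinality at most `c` with all fibers
of cardinality at most `d`. -/
theorem mk_le_mul_of_mk_fiber_le {α β : Type u} (g : α → β) {c d : Cardinal.{u}} (hβ : #β ≤ c)
    (hg : ∀ b, #{a // g a = b} ≤ d) : #α ≤ c * d := by
  rw [← mk_congr (Equiv.sigmaFiberEquiv g), mk_sigma]
  calc
    sum (fun b => #{a // g a = b}) ≤ sum (fun _ : β => d) := sum_le_sum _ _ hg
    _ = #β * d := sum_const' β d
    _ ≤ c * d := mul_le_mul_left hβ d

/-- If every initial segment of a strict total order has cardinality less than that of some other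
initial segment, and at most `κ`, then the order has cardinality at most `κ`. -/
theorem mk_le_of_growing_segments {α : Type u} (r : α → α → Prop) [IsStrictTotalOrder α r]
    {κ : Cardinal.{u}} (hκ : ℵ₀ ≤ κ) (hle : ∀ x, #{z : α | r z x} ≤ κ)
    (hgrow : ∀ x, ∃ y, #{z : α | r z x} < #{z : α | r z y}) : #α ≤ κ := by
  have hmono : ∀ {x y}, #{z : α | r z x} < #{z : α | r z y} → r x y := by
    intro x y h
    rcases trichotomous_of r x y with hxy | rfl | hyx
    · exact hxy
    · exact absurd h (lt_irrefl _)
    · have hsub : {z | r z y} ⊆ {z | r z x} := fun z hz => _root_.trans hz hyx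
      exact absurd h (mk_le_mk_of_subset hsub).not_gt
  have hlt : ∀ x, (#{z : α | r z x}).ord < κ.ord := fun x =>
    have ⟨y, hy⟩ := hgrow x
    ord_lt_ord.2 (hy.trans_le (hle y))
  let g : α → κ.ord.ToType := fun x => Ordinal.ToType.mk ⟨_, hlt x⟩
  have hg : ∀ {x y}, g x = g y → #{z : α | r z x} = #{z : α | r z y} := fun h =>
    ord_injective (congrArg Subtype.val (Ordinal.ToType.mk.injective h))
  refine (mk_le_mul_of_mk_fiber_le g (mk_ord_toType κ).le fun i => ?_).trans (mul_eq_self hκ).le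
  by_cases hi : ∃ x, g x = i
  · obtain ⟨x, rfl⟩ := hi
    obtain ⟨y, hy⟩ := hgrow x
    refine le_trans (mk_le_mk_of_subset (s := {a | g a = g x}) fun z hz => ?_) (hle y)
    exact hmono ((hg hz).trans_lt hy)
  · have : IsEmpty {a // g a = i} := ⟨fun a => hi ⟨a.1, a.2⟩⟩
    rw [mk_eq_zero]
    exact zero_le

/-- An infinite cardinal `μ` is a limit cardinal iff there is a type `α` of
cardinality `μ` with a (strict) linear order such that every `x` has some `y` above it
whose initial segment has strictly larger cardinality (the spectrum of `φ_lim`). -/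
theorem isLimit_iff_exists_order_with_growing_segments (μ : Cardinal.{u}) (hμ : ℵ₀ ≤ μ) :
    (¬ ∃ κ : Cardinal.{u}, μ = Order.succ κ) ↔
    ∃ (α : Type u) (r : α → α → Prop) (_ : IsStrictTotalOrder α r),
      #α = μ ∧ ∀ x : α, ∃ y : α, r x y ∧ #{z : α | r z x} < #{z : α | r z y} := by
  constructor
  · intro h
    refine ⟨μ.ord.ToType, (· < ·), inferInstance, mk_ord_toType μ, fun x => ?_⟩
    have hx : #{z | z < x} < μ :=
      (mk_Iio_lt x (by simp)).trans_eq (mk_ord_toType μ)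
    have hsucc : Order.succ #{z | z < x} < μ :=
      (Order.succ_le_of_lt hx).lt_of_ne fun e => h ⟨_, e.symm⟩
    let y : μ.ord.ToType := Ordinal.ToType.mk ⟨_, ord_lt_ord.2 hsucc⟩
    have hy : #{z | z < y} = Order.succ #{z | z < x} := by
      have htypein : Ordinal.typein (α := μ.ord.ToType) (· < ·) y = (Order.succ #{z | z < x}).ord :=
        Ordinal.typein_enum _ _
      exact (congrArg Ordinal.card htypein).trans (card_ord _)
    have hxy : #{z | z < x} < #{z | z < y} := hy ▸ Order.lt_succ _
    refine ⟨y, lt_of_not_ge fun hyx => hxy.not_ge ?_, hxy⟩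
    exact mk_le_mk_of_subset fun z hz => lt_of_lt_of_le hz hyx
  · rintro ⟨α, r, hr, hα, hgrow⟩ ⟨κ, rfl⟩
    have hκ : ℵ₀ ≤ κ := by
      by_contra! hlt
      exact (isSuccLimit_aleph0.succ_lt hlt).not_ge hμ
    refine (Order.lt_succ κ).not_ge (hα ▸ mk_le_of_growing_segments r hκ (fun x => ?_)
      fun x => (hgrow x).imp fun _ => And.right)
    obtain ⟨y, -, hy⟩ := hgrow x
    exact Order.le_of_lt_succ (hy.trans_le (hα ▸ mk_set_le _))
end

section
/- An infinite cardinal μ is a successor cardinal (i.e. μ = κ⁺ for some cardinal κ) if and only if there exist a type α with #α = μ and a linear order < on α together with an element x : α such that #{z : α | z < x} < μ and for every y : α with x < y one has #{z : α | z < y} = #{z : α | z < x}. (This identifies the spectrum of the sentence φ_suc of the logic with the Härtig quantifier: the class of infinite successor cardinals.) -/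
universe u

open Cardinal

/-- If every proper initial segment of an infinite linear order has cardinality at most `c`, then
the order has cardinality at most the successor of `c`. -/
theorem mk_le_succ_of_forall_mk_Iio_le {α : Type u} [LinearOrder α] [Infinite α] {c : Cardinal.{u}}
    (h : ∀ y : α, #(Set.Iio y) ≤ c) : #α ≤ Order.succ c := by
  by_contra! hlt
  obtain ⟨t, ht⟩ := le_mk_iff_exists_set.1 hlt.le
  have hcof : ∀ y, ∃ s ∈ t, y ≤ s := by
    by_contra! ⟨y, hy⟩
    exact (Order.lt_succ c).not_ge (ht ▸ (mk_le_mk_of_subset hy).trans (h y))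
  have hcover : (⋃ s : t, Set.Iic (s : α)) = Set.univ := by
    refine Set.eq_univ_of_forall fun y => ?_
    obtain ⟨s, hs, hys⟩ := hcof y
    exact Set.mem_iUnion.2 ⟨⟨s, hs⟩, hys⟩
  have hIic (y : α) : #(Set.Iic y) ≤ Order.succ c := by
    rw [← Set.Iio_insert]
    exact mk_insert_le.trans ((add_le_add_left (h y) 1).trans (add_one_le_of_lt (Order.lt_succ c)))
  have hmul : #α ≤ Order.succ c * Order.succ c := by
    rw [← mk_univ, ← hcover]
    refine (mk_iUnion_le _).trans ?_
    rw [ht]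
    exact mul_le_mul_right (ciSup_le' fun s : t => hIic s) _
  rcases lt_or_ge (Order.succ c) ℵ₀ with hfin | hinf
  · exact ((aleph0_le_mk α).trans hmul).not_gt (mul_lt_aleph0 hfin hfin)
  · rw [mul_eq_self hinf] at hmul
    exact hlt.not_ge hmul

/-- An infinite cardinal `μ` is a successor cardinal iff there is a type `α`
of cardinality `μ` with a (strict) linear order and an element `x` whose initial segment
has cardinality `< μ` and such that every later `y` determines an initial segment of the
same cardinality as that of `x` (the spectrum of `φ_suc`). -/
theorem isSucc_iff_exists_order_with_stabilizing_segments (μ : Cardinal.{u}) (hμ : ℵ₀ ≤ μ) :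
    (∃ κ : Cardinal.{u}, μ = Order.succ κ) ↔
    ∃ (α : Type u) (r : α → α → Prop) (_ : IsStrictTotalOrder α r) (x : α),
      #α = μ ∧ #{z : α | r z x} < μ ∧
      ∀ y : α, r x y → #{z : α | r z y} = #{z : α | r z x} := by
  constructor
  · rintro ⟨κ, rfl⟩
    have hκ : κ.ord < Ordinal.type (α := (Order.succ κ).ord.ToType) (· < ·) := by
      simp
    obtain ⟨x, hx⟩ := Ordinal.typein_surj (α := (Order.succ κ).ord.ToType) (· < ·) hκ
    have hcard : #(Set.Iio x) = κ :=
      (congrArg Ordinal.card hx).trans (card_ord κ)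
    have hlt (y : (Order.succ κ).ord.ToType) : #(Set.Iio y) < Order.succ κ := by
      simpa using mk_Iio_lt y (by simp)
    refine ⟨(Order.succ κ).ord.ToType, (· < ·), inferInstance, x, mk_ord_toType _,
      hlt x, fun y hxy => le_antisymm ?_ ?_⟩
    · exact (Order.lt_succ_iff.1 (hlt y)).trans hcard.ge
    · exact mk_le_mk_of_subset fun z hz => lt_trans hz hxy
  · rintro ⟨α, r, _, x, rfl, hx, hseg⟩
    classical
    let := linearOrderOfSTO r
    have : Infinite α := infinite_iff.2 hμ
    refine ⟨#{z : α | r z x}, le_antisymm (mk_le_succ_of_forall_mk_Iio_le fun y => ?_)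
      (Order.succ_le_of_lt hx)⟩
    rcases le_or_gt y x with hyx | hxy
    · exact mk_le_mk_of_subset (Set.Iio_subset_Iio hyx)
    · exact (hseg y hxy).le
end
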